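/- Let d ≥ 3 be an integer and p > 1 a real number such that (d−3)/2 − 2/(p−1) < 0, let m ≥ 1 be an integer, and let F : ℝ^m → ℝ be a defocusing potential that is homogeneous of order p+1. Then there does not exist a smooth solution u : Γ_d → ℝ^m \ {0} of □u = (∇F)(u) on Γ_d that is homogeneous of order −2/(p−1), i.e., with u(λt, λx) = λ^{−2/(p−1)} u(t,x) for all λ > 0 and (t,x) ∈ Γ_d. -/

import Mathlib

open Real MeasureTheory
open scoped RealInnerProductSpace

noncomputable section

/-- Spacetime `ℝ^{1+d}` realised as `Fin (d+1) → ℝ`; coordinate `0` is the time `t`,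
coordinates `i.succ` are the spatial coordinates `x_i`. -/
abbrev Sp (d : ℕ) := Fin (d + 1) → ℝ

/-- The Euclidean target space `ℝ^m`. -/
abbrev Em (m : ℕ) := EuclideanSpace ℝ (Fin m)

/-- The coordinate partial derivative `∂_α`. -/
def pd {d : ℕ} {E : Type*} [NormedAddCommGroup E] [NormedSpace ℝ E]
    (α : Fin (d + 1)) (f : Sp d → E) : Sp d → E :=
  fun x => fderiv ℝ f x (Pi.single α 1)

/-- The d'Alembertian `□ = -∂_t² + ∑_i ∂_{x_i}²`. -/
def dAlembert {d : ℕ} {E : Type*} [NormedAddCommGroup E] [NormedSpace ℝ E]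
    (f : Sp d → E) : Sp d → E :=
  fun x => -(pd 0 (pd 0 f) x) + ∑ i : Fin d, pd i.succ (pd i.succ f) x

/-- The (truncated, solid) light cone `Γ_d = {(t,x) : t > 0, |x| ≤ t}`,
with `|x|` the Euclidean norm. -/
def Cone (d : ℕ) : Set (Sp d) :=
  {y | 0 < y 0 ∧ ∑ i : Fin d, (y i.succ) ^ 2 ≤ (y 0) ^ 2}

/-- Second-order necessary condition at a local maximum. -/
theorem deriv_deriv_nonpos_of_isLocalMax {f : ℝ → ℝ} {x : ℝ} (h : IsLocalMax f x)
    (hc : ContinuousAt f x) : deriv (deriv f) x ≤ 0 := by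
  by_contra! hpos
  have hmin := isLocalMin_of_deriv_deriv_pos hpos h.deriv_eq_zero hc
  have hconst : f =ᶠ[nhds x] fun _ => f x := by
    filter_upwards [h, hmin] with y h1 h2 using le_antisymm h1 h2
  have h0 : deriv (deriv f) x = 0 := by
    rw [hconst.deriv.deriv_eq]
    simp
  exact hpos.ne' h0

/-- Second-order condition on `‖u‖²` along a parabola through a point where its restriction to
that parabola is locally maximal. -/
theorem inner_fderiv_fderiv_nonpos {V E : Type*} [NormedAddCommGroup V] [NormedSpace ℝ V]
    [NormedAddCommGroup E] [InnerProductSpace ℝ E] {u : V → E} {Y w z : V}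
    (hu : ContDiffAt ℝ 2 u Y)
    (hmax : ∀ᶠ s : ℝ in nhds 0, ‖u (Y + s • w + s ^ 2 • z)‖ ^ 2 ≤ ‖u Y‖ ^ 2) :
    ⟪u Y, fderiv ℝ (fderiv ℝ u) Y w w⟫ + 2 * ⟪u Y, fderiv ℝ u Y z⟫ ≤ 0 := by
  set γ : ℝ → V := fun s => Y + s • w + s ^ 2 • z with hγ
  have hγ0 : γ 0 = Y := by simp [hγ]
  have hγd : ∀ s, HasDerivAt γ (w + (2 * s) • z) s := by
    intro s
    have h1 : HasDerivAt (fun s : ℝ => s • w) ((1 : ℝ) • w) s :=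
      (hasDerivAt_id s).smul_const w
    have h2 : HasDerivAt (fun s : ℝ => s ^ 2 • z) ((2 * s) • z) s := by
      have := (hasDerivAt_pow 2 s).smul_const z
      simpa using this
    have := (h1.const_add Y).add h2
    simpa [hγ, Pi.add_def] using this
  have hγc : Filter.Tendsto γ (nhds 0) (nhds Y) := by
    have := (hγd 0).continuousAt.tendsto
    rwa [hγ0] at this
  have hd1 : ∀ᶠ x in nhds Y, DifferentiableAt ℝ u x := by
    filter_upwards [hu.eventually (by simp)] with x hx
    exact hx.differentiableAt (by simp)
  have hd2 : DifferentiableAt ℝ (fderiv ℝ u) Y :=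
    (hu.fderiv_right (m := 1) (by norm_num)).differentiableAt (by simp)
  set f : ℝ → ℝ := fun s => ‖u (γ s)‖ ^ 2 with hf
  have hderiv : ∀ᶠ s in nhds (0 : ℝ),
      HasDerivAt f (2 * ⟪u (γ s), fderiv ℝ u (γ s) (w + (2 * s) • z)⟫) s := by
    filter_upwards [hγc.eventually hd1] with s hs
    exact (hs.hasFDerivAt.comp_hasDerivAt s (hγd s)).norm_sq
  have hD : deriv f =ᶠ[nhds 0]
      fun s => 2 * ⟪u (γ s), fderiv ℝ u (γ s) (w + (2 * s) • z)⟫ := by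
    filter_upwards [hderiv] with s hs using hs.deriv
  have hloc : IsLocalMax f 0 := by
    filter_upwards [hmax] with s hs
    simpa [hf, hγ] using hs
  have hle := deriv_deriv_nonpos_of_isLocalMax hloc hderiv.self_of_nhds.continuousAt
  have hu0 : HasDerivAt (fun s => u (γ s)) (fderiv ℝ u Y w) 0 := by
    have h := hd1.self_of_nhds.hasFDerivAt
    rw [← hγ0] at h
    have := h.comp_hasDerivAt 0 (hγd 0)
    simpa [hγ0, Function.comp_def] using this
  have hL : HasDerivAt (fun s => fderiv ℝ u (γ s)) (fderiv ℝ (fderiv ℝ u) Y w) 0 := by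
    have h := hd2.hasFDerivAt
    rw [← hγ0] at h
    have := h.comp_hasDerivAt 0 (hγd 0)
    simpa [hγ0, Function.comp_def] using this
  have hv : HasDerivAt (fun s : ℝ => w + (2 * s) • z) ((2 : ℝ) • z) 0 := by
    have h2 : HasDerivAt (fun s : ℝ => 2 * s) 2 0 := by
      simpa using (hasDerivAt_id (0 : ℝ)).const_mul 2
    exact (h2.smul_const z).const_add w
  have hfin := (hu0.inner ℝ (hL.clm_apply hv)).const_mul (2 : ℝ)
  rw [hD.deriv_eq, hfin.deriv] at hle
  simp only [hγ0, mul_zero, zero_smul, add_zero, map_smul, inner_add_right,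
    real_inner_smul_right] at hle
  have := real_inner_self_nonneg (x := fderiv ℝ u Y w)
  linarith

/-- Euler's identity for functions homogeneous along a ray. -/
theorem fderiv_apply_self_of_homogeneous {V E : Type*} [NormedAddCommGroup V] [NormedSpace ℝ V]
    [NormedAddCommGroup E] [NormedSpace ℝ E] {f : V → E} {x : V} {b : ℝ}
    (hf : DifferentiableAt ℝ f x) (hom : ∀ l : ℝ, 0 < l → f (l • x) = l ^ b • f x) :
    fderiv ℝ f x x = b • f x := by
  have h1 : HasDerivAt (fun l : ℝ => f (l • x)) (fderiv ℝ f x x) 1 := by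
    have h := hf.hasFDerivAt
    rw [← one_smul ℝ x] at h
    have := h.comp_hasDerivAt (1 : ℝ) ((hasDerivAt_id (1 : ℝ)).smul_const x)
    simpa [Function.comp_def] using this
  have h2 : HasDerivAt (fun l : ℝ => l ^ b • f x) (b • f x) 1 := by
    have := (Real.hasDerivAt_rpow_const (x := 1) (p := b) (Or.inl one_ne_zero)).smul_const (f x)
    simpa using this
  have h3 : (fun l : ℝ => f (l • x)) =ᶠ[nhds 1] fun l => l ^ b • f x := by
    filter_upwards [lt_mem_nhds one_pos] with l hl using hom l hl
  exact h1.unique (h2.congr_of_eventuallyEq h3)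

/-- A function vanishing on a segment has zero derivative in its direction at the endpoint. -/
theorem fderiv_apply_eq_zero_of_segment {V E : Type*} [NormedAddCommGroup V] [NormedSpace ℝ V]
    [NormedAddCommGroup E] [NormedSpace ℝ E] {f : V → E} {x w : V}
    (hf : DifferentiableAt ℝ f x) (h0 : ∀ s ∈ Set.Icc (0 : ℝ) 1, f (x + s • w) = 0) :
    fderiv ℝ f x w = 0 := by
  have h1 : HasDerivAt (fun s : ℝ => f (x + s • w)) (fderiv ℝ f x w) 0 := by
    have h := hf.hasFDerivAt
    have hx : x + (0 : ℝ) • w = x := by simp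
    rw [← hx] at h
    have := h.comp_hasDerivAt (0 : ℝ) (((hasDerivAt_id (0 : ℝ)).smul_const w).const_add x)
    simpa [Function.comp_def] using this
  have h2 : HasDerivWithinAt (fun s : ℝ => f (x + s • w)) 0 (Set.Icc 0 1) 0 :=
    (hasDerivWithinAt_const (0 : ℝ) _ (0 : E)).congr h0 (h0 0 (by simp))
  exact (uniqueDiffOn_Icc_zero_one 0 (by simp)).eq_deriv _ h1.hasDerivWithinAt h2

/-- Derivative of Euler's identity in an admissible direction `w`. -/
theorem fderiv_fderiv_apply_of_euler {V E : Type*} [NormedAddCommGroup V] [NormedSpace ℝ V]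
    [NormedAddCommGroup E] [NormedSpace ℝ E] {u : V → E} {Y w : V} {b : ℝ}
    (hu : ContDiffAt ℝ 2 u Y)
    (h : ∀ s ∈ Set.Icc (0 : ℝ) 1, fderiv ℝ u (Y + s • w) (Y + s • w) = b • u (Y + s • w)) :
    fderiv ℝ (fderiv ℝ u) Y w Y = (b - 1) • fderiv ℝ u Y w := by
  have hd1 : HasFDerivAt u (fderiv ℝ u Y) Y := (hu.differentiableAt (by simp)).hasFDerivAt
  have hd2 : HasFDerivAt (fderiv ℝ u) (fderiv ℝ (fderiv ℝ u) Y) Y :=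
    ((hu.fderiv_right (m := 1) (by norm_num)).differentiableAt (by simp)).hasFDerivAt
  have hE := (hd2.clm_apply (hasFDerivAt_id Y)).sub (hd1.const_smul b)
  have h0 := fderiv_apply_eq_zero_of_segment (w := w) hE.differentiableAt
    (fun s hs => by simpa [sub_eq_zero] using h s hs)
  rw [hE.fderiv] at h0
  simp only [sub_apply, add_apply,
    ContinuousLinearMap.comp_apply, ContinuousLinearMap.flip_apply,
    smul_apply, ContinuousLinearMap.id_apply, id_eq] at h0
  rw [sub_eq_zero] at h0
  rw [sub_smul, one_smul, ← h0]
  abel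

/-- Euler's identity for a homogeneous potential, in gradient form. -/
theorem inner_gradient_of_homogeneous {E : Type*} [NormedAddCommGroup E] [InnerProductSpace ℝ E]
    [CompleteSpace E] {F : E → ℝ} {v : E} {b : ℝ} (hF : DifferentiableAt ℝ F v)
    (hom : ∀ l : ℝ, 0 < l → F (l • v) = l ^ b * F v) :
    ⟪v, gradient F v⟫ = b * F v := by
  rw [real_inner_comm, gradient, InnerProductSpace.toDual_symm_apply]
  exact fderiv_apply_self_of_homogeneous hF hom

/-- The trace of a bilinear form over the spatial coordinates, split along `y` and the vectors
`e i - y i • y`. -/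
theorem sum_apply_sub_smul {ι V E : Type*} [Fintype ι] [NormedAddCommGroup V] [NormedSpace ℝ V]
    [NormedAddCommGroup E] [InnerProductSpace ℝ E] (D : V →L[ℝ] V →L[ℝ] E) (v : E) (e : ι → V)
    (c : ι → ℝ) {y : V} (hy : ∑ i, c i • e i = y) :
    ∑ i, ⟪v, D (e i - c i • y) (e i - c i • y)⟫ =
      ∑ i, ⟪v, D (e i) (e i)⟫ - (2 - ∑ i, c i ^ 2) * ⟪v, D y y⟫ := by
  have h1 : ∑ i, c i * ⟪v, D (e i) y⟫ = ⟪v, D y y⟫ := by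
    have hD : D y = ∑ i, c i • D (e i) := by rw [← hy]; simp
    rw [hD]
    simp only [sum_apply, smul_apply, inner_sum, real_inner_smul_right]
  have h2 : ∑ i, c i * ⟪v, D y (e i)⟫ = ⟪v, D y y⟫ := by
    simp only [← real_inner_smul_right, ← inner_sum, ← map_smul, ← map_sum, hy]
  have h3 : ∀ i, ⟪v, D (e i - c i • y) (e i - c i • y)⟫ = ⟪v, D (e i) (e i)⟫
      - c i * ⟪v, D (e i) y⟫ - c i * ⟪v, D y (e i)⟫ + c i ^ 2 * ⟪v, D y y⟫ := by
    intro i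
    simp only [map_sub, map_smul, sub_apply, smul_apply,
      inner_sub_right, real_inner_smul_right]
    ring
  simp only [h3, Finset.sum_add_distrib, Finset.sum_sub_distrib, h1, h2, ← Finset.sum_mul]
  ring

/-- At a maximum of `‖u‖²` over the slice `{1} × closedBall 0 1`, the radial derivative is
nonnegative, and the elliptic second-order operator is controlled by it. -/
theorem maximum_principle_slice {d : ℕ} (hd : 1 ≤ d) {E : Type*} [NormedAddCommGroup E]
    [InnerProductSpace ℝ E] {u : Sp d → E} {Y : Sp d} (hu : ContDiffAt ℝ 2 u Y)
    (hY : Y 0 = 1) (hr : ∑ i : Fin d, (Y i.succ) ^ 2 ≤ 1)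
    (hmax : ∀ Z : Sp d, Z 0 = 1 → ∑ i : Fin d, (Z i.succ) ^ 2 ≤ 1 → ‖u Z‖ ^ 2 ≤ ‖u Y‖ ^ 2)
    {y : Sp d} (hy : y = Y - Pi.single 0 1) :
    0 ≤ ⟪u Y, fderiv ℝ u Y y⟫ ∧
    ∑ i : Fin d, ⟪u Y, fderiv ℝ (fderiv ℝ u) Y (Pi.single i.succ 1) (Pi.single i.succ 1)⟫
      - ⟪u Y, fderiv ℝ (fderiv ℝ u) Y y y⟫ ≤ (d - 1) * ⟪u Y, fderiv ℝ u Y y⟫ := by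
  set D := fderiv ℝ (fderiv ℝ u) Y
  have hy0 : y 0 = 0 := by simp [hy, hY]
  have hys : ∀ i : Fin d, y i.succ = Y i.succ := by simp [hy]
  have hsum : ∑ i : Fin d, Y i.succ • (Pi.single i.succ 1 : Sp d) = y := by
    ext j
    refine Fin.cases ?_ (fun k => ?_) j
    · simp [hy0, Finset.sum_apply, Fin.succ_ne_zero, eq_comm]
    · simp [hys, Finset.sum_apply, Pi.single_apply]
  have key : ∀ w z : Sp d, w 0 = 0 → z 0 = 0 →
      (∀ᶠ s : ℝ in nhds 0, ∑ i : Fin d, ((Y + s • w + s ^ 2 • z) i.succ) ^ 2 ≤ 1) →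
      ⟪u Y, D w w⟫ + 2 * ⟪u Y, fderiv ℝ u Y z⟫ ≤ 0 := by
    intro w z hw hz h
    refine inner_fderiv_fderiv_nonpos hu ?_
    filter_upwards [h] with s hs
    exact hmax _ (by simp [hw, hz, hY]) hs
  have hd' : (0 : ℝ) ≤ d - 1 := by
    have : (1 : ℝ) ≤ d := by exact_mod_cast hd
    linarith
  have hsplit := sum_apply_sub_smul D (u Y) (fun i : Fin d => (Pi.single i.succ 1 : Sp d))
    (fun i => Y i.succ) hsum
  set w : Fin d → Sp d := fun i => Pi.single i.succ 1 - Y i.succ • y with hw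
  have hw0 : ∀ i, w i 0 = 0 := by
    intro i
    simp [hw, hy0]
  rcases hr.lt_or_eq with hlt | heq
  · have hint : ∀ w z : Sp d, w 0 = 0 → z 0 = 0 →
        ⟪u Y, D w w⟫ + 2 * ⟪u Y, fderiv ℝ u Y z⟫ ≤ 0 := by
      intro w z hw hz
      refine key w z hw hz ?_
      have hc : Continuous fun s : ℝ => ∑ i : Fin d, ((Y + s • w + s ^ 2 • z) i.succ) ^ 2 := by
        simp only [Pi.add_apply, Pi.smul_apply]
        fun_prop
      have h0 : ∑ i : Fin d, ((Y + (0 : ℝ) • w + (0 : ℝ) ^ 2 • z) i.succ) ^ 2 < 1 := by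
        simpa using hlt
      exact (hc.continuousAt.eventually (gt_mem_nhds h0)).mono fun s hs => hs.le
    have hl : 0 ≤ ⟪u Y, fderiv ℝ u Y y⟫ := by
      have := hint 0 (-y) rfl (by simp [hy0])
      simp only [map_zero, inner_zero_right, map_neg, inner_neg_right] at this
      linarith
    refine ⟨hl, ?_⟩
    have hq : ∀ w : Sp d, w 0 = 0 → ⟪u Y, D w w⟫ ≤ 0 := by
      intro w hw
      simpa using hint w 0 hw rfl
    have h1 : ∑ i, ⟪u Y, D (w i) (w i)⟫ ≤ 0 := Finset.sum_nonpos fun i _ => hq _ (hw0 i)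
    have h2 := hq y hy0
    nlinarith [mul_nonneg hd' hl]
  · have hbd : ∀ v : Sp d, v 0 = 0 → ∑ i : Fin d, v i.succ * Y i.succ = 0 →
        ⟪u Y, D v v⟫ ≤ (∑ i : Fin d, (v i.succ) ^ 2) * ⟪u Y, fderiv ℝ u Y y⟫ := by
      intro v hv hvy
      have hα : ∀ α > (∑ i : Fin d, (v i.succ) ^ 2) / 2,
          ⟪u Y, D v v⟫ ≤ 2 * α * ⟪u Y, fderiv ℝ u Y y⟫ := by
        intro α hα
        have h := key v ((-α) • y) hv (by simp [hy0]) ?_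
        · simp only [map_smul, real_inner_smul_right] at h
          linarith
        have hc : Continuous fun s : ℝ => α ^ 2 * s ^ 2 := by fun_prop
        have hpos : α ^ 2 * (0 : ℝ) ^ 2 < 2 * α - ∑ i : Fin d, (v i.succ) ^ 2 := by
          simp only [ne_eq, OfNat.ofNat_ne_zero, not_false_eq_true, zero_pow, mul_zero]
          linarith
        filter_upwards [hc.continuousAt.eventually (gt_mem_nhds hpos)] with s hs
        have hexp : ∑ i : Fin d, ((Y + s • v + s ^ 2 • ((-α) • y)) i.succ) ^ 2 =
            (1 - α * s ^ 2) ^ 2 * ∑ i : Fin d, (Y i.succ) ^ 2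
            + 2 * s * (1 - α * s ^ 2) * ∑ i : Fin d, v i.succ * Y i.succ
            + s ^ 2 * ∑ i : Fin d, (v i.succ) ^ 2 := by
          simp only [Finset.mul_sum, ← Finset.sum_add_distrib]
          refine Finset.sum_congr rfl fun i _ => ?_
          simp only [Pi.add_apply, Pi.smul_apply, smul_eq_mul, hys]
          ring
        rw [hexp, heq, hvy]
        nlinarith [mul_le_mul_of_nonneg_left hs.le (sq_nonneg s)]
      have hc : Continuous fun α : ℝ => 2 * α * ⟪u Y, fderiv ℝ u Y y⟫ := by fun_prop
      have ht := (hc.tendsto ((∑ i : Fin d, (v i.succ) ^ 2) / 2)).mono_left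
        (nhdsWithin_le_nhds (s := Set.Ioi ((∑ i : Fin d, (v i.succ) ^ 2) / 2)))
      have := ge_of_tendsto ht (Filter.eventually_of_mem self_mem_nhdsWithin hα)
      linarith
    have hl : 0 ≤ ⟪u Y, fderiv ℝ u Y y⟫ := by
      have h := key 0 (-y) rfl (by simp [hy0]) ?_
      · simp only [map_zero, inner_zero_right, map_neg, inner_neg_right] at h
        linarith
      have hc : Continuous fun s : ℝ => s ^ 2 := by fun_prop
      have hpos : (0 : ℝ) ^ 2 < 1 := by norm_num
      filter_upwards [hc.continuousAt.eventually (gt_mem_nhds hpos)] with s hs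
      have hexp : ∑ i : Fin d, ((Y + s • (0 : Sp d) + s ^ 2 • -y) i.succ) ^ 2 =
          (1 - s ^ 2) ^ 2 * ∑ i : Fin d, (Y i.succ) ^ 2 := by
        simp only [Finset.mul_sum]
        refine Finset.sum_congr rfl fun i _ => ?_
        simp only [Pi.add_apply, Pi.smul_apply, Pi.neg_apply, Pi.zero_apply, smul_eq_mul, hys]
        ring
      rw [hexp, heq]
      nlinarith [sq_nonneg s]
    refine ⟨hl, ?_⟩
    have hwj : ∀ i j : Fin d, w i j.succ = (if j = i then 1 else 0) - Y i.succ * Y j.succ := by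
      intro i j
      simp [hw, hys, Pi.single_apply]
    have hwY : ∀ i, ∑ j : Fin d, w i j.succ * Y j.succ = 0 := by
      intro i
      simp only [hwj, sub_mul, Finset.sum_sub_distrib, ite_mul, one_mul, zero_mul,
        Finset.sum_ite_eq', Finset.mem_univ, if_true]
      have : ∑ j : Fin d, Y i.succ * Y j.succ * Y j.succ
          = Y i.succ * ∑ j : Fin d, (Y j.succ) ^ 2 := by
        rw [Finset.mul_sum]
        exact Finset.sum_congr rfl fun j _ => by ring
      rw [this, heq]
      ring
    have hww : ∀ i, ∑ j : Fin d, (w i j.succ) ^ 2 = 1 - (Y i.succ) ^ 2 := by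
      intro i
      have : ∑ j : Fin d, (w i j.succ) ^ 2
          = ∑ j : Fin d, w i j.succ * (if j = i then 1 else 0)
            - Y i.succ * ∑ j : Fin d, w i j.succ * Y j.succ := by
        rw [Finset.mul_sum, ← Finset.sum_sub_distrib]
        refine Finset.sum_congr rfl fun j _ => ?_
        rw [sq]
        nth_rewrite 2 [hwj]
        ring
      rw [this, hwY]
      simp [hwj]
      ring
    have h1 : ∑ i, ⟪u Y, D (w i) (w i)⟫
        ≤ ∑ i : Fin d, (1 - (Y i.succ) ^ 2) * ⟪u Y, fderiv ℝ u Y y⟫ :=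
      Finset.sum_le_sum fun i _ => by
        rw [← hww i]
        exact hbd _ (hw0 i) (hwY i)
    rw [← Finset.sum_mul, Finset.sum_sub_distrib, heq] at h1
    simp only [Finset.sum_const, Finset.card_univ, Fintype.card_fin, nsmul_eq_mul,
      mul_one] at h1
    rw [heq] at hsplit
    linarith

/-- The slice `{1} × closedBall 0 1` of the light cone is compact. -/
theorem isCompact_slice (d : ℕ) :
    IsCompact {Z : Sp d | Z 0 = 1 ∧ ∑ i : Fin d, (Z i.succ) ^ 2 ≤ 1} := by
  refine (isCompact_Icc (a := (fun _ => -1 : Sp d)) (b := fun _ => 1)).of_isClosed_subset ?_ ?_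
  · have h : Continuous fun Z : Sp d => ∑ i : Fin d, (Z i.succ) ^ 2 := by fun_prop
    exact (isClosed_eq (continuous_apply 0) continuous_const).inter
      (isClosed_le h continuous_const)
  · rintro Z ⟨h0, h1⟩
    have h : ∀ j, |Z j| ≤ 1 := by
      intro j
      refine Fin.cases (by simp [h0]) (fun k => ?_) j
      rw [← sq_le_one_iff_abs_le_one]
      exact (Finset.single_le_sum (f := fun i : Fin d => (Z i.succ) ^ 2)
        (fun i _ => sq_nonneg _) (Finset.mem_univ k)).trans h1
    exact ⟨fun j => (abs_le.mp (h j)).1, fun j => (abs_le.mp (h j)).2⟩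

/-- Pure second partial derivatives as values of the second Fréchet derivative. -/
theorem pd_pd_apply {d : ℕ} {E : Type*} [NormedAddCommGroup E] [NormedSpace ℝ E] {u : Sp d → E}
    {Y : Sp d} (hu : ContDiffAt ℝ 2 u Y) (α : Fin (d + 1)) :
    pd α (pd α u) Y = fderiv ℝ (fderiv ℝ u) Y (Pi.single α 1) (Pi.single α 1) := by
  have hd2 : HasFDerivAt (fderiv ℝ u) (fderiv ℝ (fderiv ℝ u) Y) Y :=
    ((hu.fderiv_right (m := 1) (by norm_num)).differentiableAt (by simp)).hasFDerivAt
  have h := hd2.clm_apply (hasFDerivAt_const (Pi.single α 1 : Sp d) Y)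
  unfold pd
  rw [h.fderiv]
  simp

/-- The second time derivative of a homogeneous function on the slice `t = 1`, in terms of
the spatial part `y` of the base point. -/
theorem fderiv_fderiv_time {d : ℕ} {E : Type*} [NormedAddCommGroup E] [NormedSpace ℝ E]
    {u : Sp d → E} {Y y : Sp d} {a : ℝ} (hu : ∀ z ∈ Cone d, ContDiffAt ℝ 2 u z)
    (hom : ∀ l : ℝ, 0 < l → ∀ z ∈ Cone d, u (l • z) = l ^ (-a) • u z)
    (hY : Y 0 = 1) (hr : ∑ i : Fin d, (Y i.succ) ^ 2 ≤ 1) (hy : y = Y - Pi.single 0 1) :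
    fderiv ℝ (fderiv ℝ u) Y (Pi.single 0 1) (Pi.single 0 1) =
      (a * (a + 1)) • u Y + (2 * (a + 1)) • fderiv ℝ u Y y + fderiv ℝ (fderiv ℝ u) Y y y := by
  have hYC : Y ∈ Cone d := ⟨by simp [hY], by simpa [hY] using hr⟩
  have euler : ∀ z ∈ Cone d, fderiv ℝ u z z = (-a) • u z := fun z hz =>
    fderiv_apply_self_of_homogeneous ((hu z hz).differentiableAt (by simp))
      fun l hl => hom l hl z hz
  have h1 : fderiv ℝ (fderiv ℝ u) Y (Pi.single 0 1) Y
      = (-a - 1) • fderiv ℝ u Y (Pi.single 0 1) := by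
    refine fderiv_fderiv_apply_of_euler (hu Y hYC) fun s hs => euler _ ⟨?_, ?_⟩
    · simp [hY]
      linarith [hs.1]
    · simp [hY]
      nlinarith [hs.1]
  have h2 : fderiv ℝ (fderiv ℝ u) Y (-y) Y = (-a - 1) • fderiv ℝ u Y (-y) := by
    refine fderiv_fderiv_apply_of_euler (hu Y hYC) fun s hs => euler _ ⟨?_, ?_⟩
    · simp [hy, hY]
    · have : ∑ i : Fin d, ((Y + s • -y) i.succ) ^ 2
          = (1 - s) ^ 2 * ∑ i : Fin d, (Y i.succ) ^ 2 := by
        rw [Finset.mul_sum]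
        refine Finset.sum_congr rfl fun i _ => ?_
        simp [hy]
        ring
      rw [this]
      have h0 : (1 - s) ^ 2 ≤ 1 := by nlinarith [hs.1, hs.2]
      simp [hy, hY]
      nlinarith [Finset.sum_nonneg fun (i : Fin d) (_ : i ∈ Finset.univ) =>
        sq_nonneg (Y i.succ), sq_nonneg (1 - s)]
  have h3 : fderiv ℝ (fderiv ℝ u) Y (Pi.single 0 1) y
      = fderiv ℝ (fderiv ℝ u) Y y (Pi.single 0 1) :=
    (hu Y hYC).isSymmSndFDerivAt (by simp) _ _
  have h4 := euler Y hYC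
  have hYy : Y = Pi.single 0 1 + y := by rw [hy]; abel
  set D := fderiv ℝ (fderiv ℝ u) Y
  set L := fderiv ℝ u Y
  have hDY : ∀ v, D v Y = D v (Pi.single 0 1) + D v y := by
    intro v
    rw [← map_add, ← hYy]
  have hLY : L Y = L (Pi.single 0 1) + L y := by
    rw [← map_add, ← hYy]
  rw [hDY, h3] at h1
  simp only [map_neg, neg_apply, smul_neg, neg_inj] at h2
  rw [hDY] at h2
  rw [hLY] at h4
  rw [← eq_sub_iff_add_eq] at h1 h2 h4
  rw [h1, h2, h4]
  module

/-- Proposition 2.2, no self-similar defocusing solutions.  For `d ≥ 3`,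
`p > 1` with `(d-3)/2 - 2/(p-1) < 0`, `m ≥ 1`, and `F` a defocusing potential homogeneous
of order `p+1`, there is no smooth nowhere-vanishing solution `u : Γ_d → ℝ^m \ {0}` of
`□u = ∇F(u)` that is homogeneous of order `-2/(p-1)`. -/
theorem stmt3 (d : ℕ) (hd : 3 ≤ d) (p : ℝ) (hp : 1 < p)
    (hcond : ((d : ℝ) - 3) / 2 - 2 / (p - 1) < 0) (m : ℕ) (hm : 1 ≤ m)
    (F : Em m → ℝ)
    (hFsmooth : ContDiffOn ℝ (⊤ : ℕ∞) F {0}ᶜ)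
    (hFpos : ∀ v : Em m, v ≠ 0 → 0 < F v)
    (hFhom : ∀ l : ℝ, 0 < l → ∀ v : Em m, F (l • v) = l ^ (p + 1) * F v) :
    ¬ ∃ (u : Sp d → Em m) (Ω : Set (Sp d)),
        IsOpen Ω ∧ Cone d ⊆ Ω ∧ ContDiffOn ℝ (⊤ : ℕ∞) u Ω ∧
        (∀ y ∈ Cone d, u y ≠ 0) ∧
        (∀ y ∈ Cone d, dAlembert u y = gradient F (u y)) ∧
        -- homogeneity of order `-2/(p-1)`
        (∀ l : ℝ, 0 < l → ∀ y ∈ Cone d, u (l • y) = l ^ (-(2 / (p - 1))) • u y) := by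
  rintro ⟨u, Ω, hΩ, hCΩ, husmooth, hune, heq, hom⟩
  have hu : ∀ z ∈ Cone d, ContDiffAt ℝ 2 u z := fun z hz =>
    (husmooth.contDiffAt (hΩ.mem_nhds (hCΩ hz))).of_le (WithTop.coe_le_coe.mpr (le_top : (2 : ℕ∞) ≤ ⊤))
  have hslice : ∀ Z : Sp d, Z 0 = 1 → ∑ i : Fin d, (Z i.succ) ^ 2 ≤ 1 → Z ∈ Cone d :=
    fun Z h0 h1 => ⟨by simp [h0], by simpa [h0] using h1⟩
  obtain ⟨Y, ⟨hY, hr⟩, hmax⟩ := (isCompact_slice d).exists_isMaxOn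
    (f := fun Z => ‖u Z‖ ^ 2) ⟨Pi.single 0 1, by simp⟩
    (fun Z hZ => ((hu Z (hslice Z hZ.1 hZ.2)).continuousAt.norm.pow 2).continuousWithinAt)
  have hYC := hslice Y hY hr
  obtain ⟨hl, hell⟩ := maximum_principle_slice (by omega) (hu Y hYC) hY hr
    (fun Z h0 h1 => hmax ⟨h0, h1⟩) rfl
  have htime := congrArg (fun v => ⟪u Y, v⟫) (fderiv_fderiv_time hu hom hY hr rfl)
  have hgrad := inner_gradient_of_homogeneous
    ((hFsmooth.contDiffAt (isOpen_compl_singleton.mem_nhds (hune Y hYC))).differentiableAt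
      (by simp)) (fun l hlpos => hFhom l hlpos (u Y))
  rw [← heq Y hYC] at hgrad
  simp only [dAlembert, pd_pd_apply (hu Y hYC), inner_add_right, inner_neg_right, inner_sum]
    at hgrad
  simp only [inner_add_right, real_inner_smul_right] at htime
  have ha : 0 < 2 / (p - 1) := div_pos two_pos (by linarith)
  have hFY := mul_pos (show 0 < p + 1 by linarith) (hFpos _ (hune Y hYC))
  have hself := mul_nonneg (mul_pos ha (show 0 < 2 / (p - 1) + 1 by linarith)).le
    (real_inner_self_nonneg (x := u Y))
  have hcoef := mul_nonneg (show 0 ≤ 2 * (2 / (p - 1) + 1) - ((d : ℝ) - 1) by linarith) hl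
  linarith
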